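/- There exist countable classes of environments which are not value-stable but for which a self-optimizing policy exists. Specifically, the countable class {ν_s : s > 0} defined by: actions y_i ∈ {a,b}, rewards r_i ∈ {0,1,2}, n_i := #{j ≤ i : y_j = a}, and in ν_s the reward for action a is always 1, while the reward for action b at step i is 2 if the longest consecutive run of action b taken so far exceeds n_i and n_i ≥ s, and 0 otherwise — no environment ν_s in this class is value-stable (any witness requires d(k,ε) = k ≠ o(k)), yet there exists a policy p with V(ν_s,p) = V*_{ν_s} for every s > 0. -/

import Mathlib

open MeasureTheory Filter Finset Asymptotics
open scoped ENNReal Classical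

noncomputable section

namespace RL

/-- A perception `x = (r, o)`: a reward `r ∈ R = {0, …, r_max}` together with an
observation `o ∈ O`. -/
abbrev Percept (O : Type) (rmax : ℕ) := Fin (rmax + 1) × O

/-- A cycle `z = (y, r, o)`: an action together with the resulting perception. -/
abbrev Cycle (Y O : Type) (rmax : ℕ) := Y × Percept O rmax

/-- A deterministic policy maps a history `z_{<k}` to the next action `y_k`. -/
abbrev Policy (Y O : Type) (rmax : ℕ) := List (Cycle Y O rmax) → Y

/-- An infinite interaction sequence. -/
abbrev Traj (Y O : Type) (rmax : ℕ) := ℕ → Cycle Y O rmax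

instance (Y O : Type) (rmax : ℕ) : MeasurableSpace (Cycle Y O rmax) := ⊤

/-- The reward of a cycle `z = (y, (r, o))`, as a real number. -/
def rew {Y O : Type} {rmax : ℕ} (z : Cycle Y O rmax) : ℝ := ((z.2.1 : ℕ) : ℝ)

/-- The cylinder set of all infinite sequences extending the finite sequence `l`. -/
def cylSet {A : Type} (l : List A) : Set (ℕ → A) := {ω | ∀ i : Fin l.length, ω i.1 = l.get i}

/-- An environment: conditional probabilities `ν(x_k | z_{<k} y_k)` of the next perception
given the history, together with, for each (deterministic) policy `p`, the induced
probability measure on interaction sequences, which on cylinder sets is given by the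
product of the conditional probabilities (actions being forced by the policy). -/
structure Environment (Y O : Type) [Fintype Y] [Fintype O] (rmax : ℕ) where
  cond : List (Cycle Y O rmax) → Y → Percept O rmax → ℝ
  cond_nonneg : ∀ h y x, 0 ≤ cond h y x
  cond_sum_one : ∀ h y, ∑ x : Percept O rmax, cond h y x = 1
  P : Policy Y O rmax → Measure (Traj Y O rmax)
  P_prob : ∀ p, IsProbabilityMeasure (P p)
  P_cyl : ∀ (p : Policy Y O rmax) (h : List (Cycle Y O rmax)) (z : Cycle Y O rmax),
    P p (cylSet (h ++ [z]))
      = P p (cylSet h) * ENNReal.ofReal (if z.1 = p h then cond h z.1 z.2 else 0)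

variable {Y O : Type} [Fintype Y] [Fintype O] {rmax : ℕ}

/-- The average reward `(1/m) r_{1..m}` of the first `m` steps of a trajectory. -/
def avg {Y O : Type} {rmax : ℕ} (ω : Traj Y O rmax) (m : ℕ) : ℝ :=
  (∑ i ∈ Finset.range m, rew (ω i)) / m

/-- `V(ν,p) = V` : the average limiting value exists a.s. and equals the constant `V`. -/
def ValueIs (ν : Environment Y O rmax) (p : Policy Y O rmax) (V : ℝ) : Prop :=
  ν.P p {ω | Tendsto (avg ω) atTop (nhds V)} = 1

/-- `V̄(ν,p) = V` : the upper limiting average value is a.s. the constant `V`. -/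
def UpperValueIs (ν : Environment Y O rmax) (p : Policy Y O rmax) (V : ℝ) : Prop :=
  ν.P p {ω | limsup (avg ω) atTop = V} = 1

/-- `V` is the optimal value `V*_ν` of `ν`: some policy `p_ν` achieves average value `V`
a.s., and every policy has upper average value `≤ V` a.s. -/
def IsOptimalValue (ν : Environment Y O rmax) (V : ℝ) : Prop :=
  ∃ p, ValueIs ν p V ∧ ∀ q : Policy Y O rmax, ν.P q {ω | limsup (avg ω) atTop ≤ V} = 1

/-- An environment is explorable if it has an optimal value `V*_ν`. -/
def Explorable (ν : Environment Y O rmax) : Prop := ∃ V, IsOptimalValue ν V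

/-- `V` is the upper optimal value `V̄*_ν` of `ν`. -/
def IsUpperOptimalValue (ν : Environment Y O rmax) (V : ℝ) : Prop :=
  ∃ p, UpperValueIs ν p V ∧ ∀ q : Policy Y O rmax, ν.P q {ω | limsup (avg ω) atTop ≤ V} = 1

/-- An environment is upper explorable if it has an upper optimal value `V̄*_ν`. -/
def UpperExplorable (ν : Environment Y O rmax) : Prop := ∃ V, IsUpperOptimalValue ν V

/-- `ν(x_{<k} | y_{<k})` : the probability of the perceptions of the history `h`,
given its actions. -/
def histProbX (ν : Environment Y O rmax) (h : List (Cycle Y O rmax)) : ℝ :=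
  ∏ i : Fin h.length, ν.cond (h.take i.1) (h.get i).1 (h.get i).2

/-- Replace the first `k-1` actions of the policy `p` by the actions `y_{<k}` of the
history `h`. -/
def replacePolicy (h : List (Cycle Y O rmax)) (p : Policy Y O rmax) : Policy Y O rmax :=
  fun l => if hl : l.length < h.length then (h.get ⟨l.length, hl⟩).1 else p l

/-- The measure induced by `(p, ν)` conditional on the history `h = z_{<k}`:
`ν`-probabilities conditional on `x_{<k}`, with the first `k-1` actions of `p`
replaced by `y_{<k}`. -/
def condMeasure (ν : Environment Y O rmax) (p : Policy Y O rmax)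
    (h : List (Cycle Y O rmax)) : Measure (Traj Y O rmax) :=
  ProbabilityTheory.cond (ν.P (replacePolicy h p)) (cylSet h)

/-- `P( · | z_{<k})` under policy `p` in environment `ν`. -/
def condProb (ν : Environment Y O rmax) (p : Policy Y O rmax)
    (h : List (Cycle Y O rmax)) (A : Set (Traj Y O rmax)) : ℝ≥0∞ :=
  condMeasure ν p h A

/-- `V(ν,p,z_{<k}) = V` : conditional on `z_{<k}`, the average limiting value is a.s. `V`. -/
def CondValueIs (ν : Environment Y O rmax) (p : Policy Y O rmax)
    (h : List (Cycle Y O rmax)) (V : ℝ) : Prop :=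
  condProb ν p h {ω | Tendsto (avg ω) atTop (nhds V)} = 1

/-- `V̄(ν,p,z_{<k}) = V` : conditional on `z_{<k}`, the upper limiting average value
is a.s. `V`. -/
def CondUpperValueIs (ν : Environment Y O rmax) (p : Policy Y O rmax)
    (h : List (Cycle Y O rmax)) (V : ℝ) : Prop :=
  condProb ν p h {ω | limsup (avg ω) atTop = V} = 1

/-- `V` is the conditional optimal value `V*_ν(z_{<k})`. -/
def IsCondOptimalValue (ν : Environment Y O rmax) (h : List (Cycle Y O rmax)) (V : ℝ) : Prop :=
  ∃ p, CondValueIs ν p h V ∧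
    ∀ q : Policy Y O rmax, condProb ν q h {ω | limsup (avg ω) atTop ≤ V} = 1

/-- `V` is the conditional upper optimal value `V̄*_ν(z_{<k})`. -/
def IsCondUpperOptimalValue (ν : Environment Y O rmax) (h : List (Cycle Y O rmax)) (V : ℝ) :
    Prop :=
  ∃ p, CondUpperValueIs ν p h V ∧
    ∀ q : Policy Y O rmax, condProb ν q h {ω | limsup (avg ω) atTop ≤ V} = 1

/-- Strongly explorable: after any history of positive probability there is a conditionally
optimal value. -/
def StronglyExplorable (ν : Environment Y O rmax) : Prop :=
  ∀ h, 0 < histProbX ν h → ∃ V, IsCondOptimalValue ν h V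

/-- Strongly upper explorable. -/
def StronglyUpperExplorable (ν : Environment Y O rmax) : Prop :=
  ∀ h, 0 < histProbX ν h → ∃ V, IsCondUpperOptimalValue ν h V

/-- The worst-case optimal value `W*_ν = inf_{z_{<k}} V*_ν(z_{<k})`. -/
def Wstar (ν : Environment Y O rmax) : ℝ :=
  sInf {V | ∃ h, 0 < histProbX ν h ∧ IsCondOptimalValue ν h V}

/-- The worst-case upper optimal value `W̄*_ν = inf_{z_{<k}} V̄*_ν(z_{<k})`. -/
def WstarUpper (ν : Environment Y O rmax) : ℝ :=
  sInf {V | ∃ h, 0 < histProbX ν h ∧ IsCondUpperOptimalValue ν h V}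

/-- Recoverable: after any history of positive probability, some policy attains the
upper optimal value `V̄*_ν` with conditional probability 1. -/
def Recoverable (ν : Environment Y O rmax) : Prop :=
  ∃ V, IsUpperOptimalValue ν V ∧
    ∀ h, 0 < histProbX ν h →
      ∃ p, condProb ν p h {ω | limsup (avg ω) atTop = V} = 1

/-- The quantitative part of value-stability, with target value `W`:
rewards `r_i ∈ [0, r_max]` with `(1/n) r_{1..n} → W`, `d(k,ε) = o(k)`,
`Σ_n φ(n,ε) < ∞`, and from any history `z_{<k}` some policy `p` recovers:
`P( r_{k..k+n} − r^{pν}_{k..k+n} > d(k,ε) + nε | z_{<k} ) ≤ φ(n,ε)`. -/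
def ValueStableCore (ν : Environment Y O rmax) (W : ℝ) (r : ℕ → ℝ)
    (d : ℕ → ℝ → ℝ) (φ : ℕ → ℝ → ℝ) : Prop :=
  (∀ i, r i ∈ Set.Icc (0 : ℝ) (rmax : ℝ)) ∧
  Tendsto (fun n => (∑ i ∈ Finset.range n, r i) / n) atTop (nhds W) ∧
  (∀ ε : ℝ, 0 < ε → (fun k : ℕ => d k ε) =o[atTop] fun k : ℕ => (k : ℝ)) ∧
  (∀ ε : ℝ, 0 < ε → Summable fun n => φ n ε) ∧
  ∀ h : List (Cycle Y O rmax), ∃ p : Policy Y O rmax, ∀ ε : ℝ, 0 < ε → ∀ n : ℕ,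
    condProb ν p h
      {ω | d h.length ε + n * ε <
        (∑ i ∈ Finset.Icc h.length (h.length + n), r i)
          - ∑ i ∈ Finset.Icc h.length (h.length + n), rew (ω i)}
      ≤ ENNReal.ofReal (φ n ε)

/-- Value-stability with explicit witnesses `V = V*_ν`, `r`, `d`, `φ`. -/
def ValueStableWith (ν : Environment Y O rmax) (V : ℝ) (r : ℕ → ℝ)
    (d : ℕ → ℝ → ℝ) (φ : ℕ → ℝ → ℝ) : Prop :=
  IsOptimalValue ν V ∧ ValueStableCore ν V r d φ

/-- A value-stable environment. -/
def ValueStable (ν : Environment Y O rmax) : Prop :=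
  ∃ V r d φ, ValueStableWith ν V r d φ

/-- A worst-case value-stable environment: strongly explorable, and the value-stability
condition holds with target `W*_ν`. -/
def WorstCaseValueStable (ν : Environment Y O rmax) : Prop :=
  StronglyExplorable ν ∧ ∃ r d φ, ValueStableCore ν (Wstar ν) r d φ

/-- A policy is self-optimizing for a class `C` if it attains the optimal value `V*_ν`
in every `ν ∈ C`. -/
def SelfOptimizing (p : Policy Y O rmax) (C : Set (Environment Y O rmax)) : Prop :=
  ∀ ν ∈ C, ∀ V, IsOptimalValue ν V → ValueIs ν p V

/-- A policy is upper self-optimizing for a class `C` if it attains the upper optimal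
value `V̄*_ν` in every `ν ∈ C`. -/
def UpperSelfOptimizing (p : Policy Y O rmax) (C : Set (Environment Y O rmax)) : Prop :=
  ∀ ν ∈ C, ∀ V, IsUpperOptimalValue ν V → UpperValueIs ν p V

/-- A deterministic environment: all conditional probabilities are `0` or `1`. -/
def Deterministic (ν : Environment Y O rmax) : Prop :=
  ∀ h y x, ν.cond h y x = 0 ∨ ν.cond h y x = 1

/-- In a deterministic environment, the perception following history `h` and action `y`. -/
def pick [Nonempty O] (ν : Environment Y O rmax) (h : List (Cycle Y O rmax)) (y : Y) :
    Percept O rmax :=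
  if hx : ∃ x, ν.cond h y x = 1 then hx.choose else Classical.arbitrary _

/-- The (deterministic) history generated by policy `p` in a deterministic environment. -/
def detHist [Nonempty O] (ν : Environment Y O rmax) (p : Policy Y O rmax) :
    ℕ → List (Cycle Y O rmax)
  | 0 => []
  | n + 1 =>
      detHist ν p n ++ [(p (detHist ν p n), pick ν (detHist ν p n) (p (detHist ν p n)))]

/-- The cycle `z_n` generated by policy `p` in a deterministic environment. -/
def detZ [Nonempty O] (ν : Environment Y O rmax) (p : Policy Y O rmax) (n : ℕ) :
    Cycle Y O rmax :=
  (p (detHist ν p n), pick ν (detHist ν p n) (p (detHist ν p n)))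

end RL

namespace RL

/-- `n_i`: the number of times action `a` (encoded `true`) has been taken. -/
def countA (l : List Bool) : ℕ := l.count true

/-- The length of the longest consecutive run of action `b` (encoded `false`). -/
def longestRunB (l : List Bool) : ℕ :=
  (l.foldl
    (fun st y => if y then (0, st.2) else (st.1 + 1, max st.2 (st.1 + 1)))
    ((0, 0) : ℕ × ℕ)).2

/-- The (deterministic) reward of environment `ν_s` after previous actions `prev` and
current action `y`: action `a` always gets reward `1`; action `b` gets reward `2` if the
longest consecutive run of action `b` taken so far exceeds `n_i` and `n_i ≥ s`, and `0`
otherwise. -/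
def nuSReward (s : ℕ) (prev : List Bool) (y : Bool) : Fin 3 :=
  if y then 1
  else if countA (prev ++ [y]) < longestRunB (prev ++ [y]) ∧ s ≤ countA (prev ++ [y])
    then 2 else 0

/-- `ν` is the environment `ν_s` (actions `a = true`, `b = false`; rewards in `{0,1,2}`;
no observations). -/
def IsNuS (ν : Environment Bool Unit 2) (s : ℕ) : Prop :=
  ∀ h y x, ν.cond h y x = if x.1 = nuSReward s (h.map Prod.fst) y then 1 else 0

/-- The pair (length of the current run of `b`, length of the longest run of `b`). -/
def runState (l : List Bool) : ℕ × ℕ :=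
  l.foldl (fun st y => if y then (0, st.2) else (st.1 + 1, max st.2 (st.1 + 1))) (0, 0)

lemma longestRunB_eq (l : List Bool) : longestRunB l = (runState l).2 := rfl

lemma runState_append (l : List Bool) (y : Bool) :
    runState (l ++ [y]) = if y then (0, (runState l).2)
      else ((runState l).1 + 1, max (runState l).2 ((runState l).1 + 1)) := by
  simp [runState, List.foldl_append]

lemma countA_append (l : List Bool) (y : Bool) :
    countA (l ++ [y]) = countA l + if y then 1 else 0 := by
  cases y <;> simp [countA]

lemma runState_fst_le (l : List Bool) : (runState l).1 ≤ (runState l).2 := by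
  induction l using List.reverseRecOn with
  | nil => simp [runState]
  | append_singleton l y ih => cases y <;> simp [runState_append]

lemma runState_snd_add_countA_le (l : List Bool) :
    (runState l).2 + countA l ≤ l.length := by
  induction l using List.reverseRecOn with
  | nil => simp [runState, countA]
  | append_singleton l y ih =>
    have := runState_fst_le l
    cases y <;> simp [runState_append, countA_append] <;> omega

lemma length_le_countA_mul (l : List Bool) :
    l.length ≤ countA l * (1 + (runState l).2) + (runState l).1 := by
  induction l using List.reverseRecOn with
  | nil => simp
  | append_singleton l y ih =>
    have := runState_fst_le l
    cases y
    · have h : countA l * (1 + (runState l).2) ≤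
          countA l * (1 + max (runState l).2 ((runState l).1 + 1)) := by
        gcongr
        exact le_max_left _ _
      simp [runState_append, countA_append] at *
      omega
    · simp [runState_append, countA_append, add_mul] at *
      omega

lemma countA_lt_longestRunB (l : List Bool) (h : (countA l + 1) ^ 2 ≤ l.length) :
    countA l < longestRunB l := by
  rw [longestRunB_eq]
  by_contra! hL
  have h1 := length_le_countA_mul l
  have h2 := runState_fst_le l
  nlinarith [Nat.mul_le_mul_left (countA l) hL]

/-- The history of length `n` produced by the policy `p` in `ν_s`. -/
def nuSHist (s : ℕ) (p : Policy Bool Unit 2) : ℕ → List (Cycle Bool Unit 2)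
  | 0 => []
  | n + 1 => nuSHist s p n ++ [(p (nuSHist s p n),
      (nuSReward s ((nuSHist s p n).map Prod.fst) (p (nuSHist s p n)), ()))]

/-- The trajectory produced by the policy `p` in `ν_s`. -/
def nuSTraj (s : ℕ) (p : Policy Bool Unit 2) : Traj Bool Unit 2 := fun n =>
  (p (nuSHist s p n), (nuSReward s ((nuSHist s p n).map Prod.fst) (p (nuSHist s p n)), ()))

lemma nuSHist_succ (s : ℕ) (p : Policy Bool Unit 2) (n : ℕ) :
    nuSHist s p (n + 1) = nuSHist s p n ++ [nuSTraj s p n] := rfl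

lemma nuSHist_eq_map (s : ℕ) (p : Policy Bool Unit 2) (n : ℕ) :
    nuSHist s p n = (List.range n).map (nuSTraj s p) := by
  induction n with
  | zero => rfl
  | succ n ih => rw [nuSHist_succ, ih, List.range_succ, List.map_append]; rfl

lemma length_nuSHist (s : ℕ) (p : Policy Bool Unit 2) (n : ℕ) :
    (nuSHist s p n).length = n := by
  simp [nuSHist_eq_map]

lemma mem_cylSet_nuSHist (s : ℕ) (p : Policy Bool Unit 2) (n : ℕ) (ω : Traj Bool Unit 2) :
    ω ∈ cylSet (nuSHist s p n) ↔ ∀ i < n, ω i = nuSTraj s p i := by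
  rw [nuSHist_eq_map]
  constructor
  · intro h i hi
    simpa using h ⟨i, by simpa using hi⟩
  · rintro h ⟨i, hi⟩
    simpa using h i (by simpa using hi)

lemma P_cylSet_nuSHist {ν : Environment Bool Unit 2} {s : ℕ} (hν : IsNuS ν s)
    (p : Policy Bool Unit 2) (n : ℕ) : ν.P p (cylSet (nuSHist s p n)) = 1 := by
  have := ν.P_prob p
  induction n with
  | zero =>
    have : cylSet (nuSHist s p 0) = Set.univ :=
      Set.eq_univ_of_forall fun ω => (mem_cylSet_nuSHist s p 0 ω).2 (by simp)
    rw [this, measure_univ]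
  | succ n ih =>
    rw [nuSHist_succ, ν.P_cyl, ih, hν]
    simp [nuSTraj]

lemma measurableSet_cylSet (h : List (Cycle Bool Unit 2)) : MeasurableSet (cylSet h) := by
  have : cylSet h =
      ⋂ i : Fin h.length, (fun ω : Traj Bool Unit 2 => ω i.1) ⁻¹' {h.get i} := by
    ext ω; simp [cylSet]
  rw [this]
  exact MeasurableSet.iInter fun i => measurable_pi_apply i.1 trivial

lemma P_singleton_nuSTraj {ν : Environment Bool Unit 2} {s : ℕ} (hν : IsNuS ν s)
    (p : Policy Bool Unit 2) : ν.P p {nuSTraj s p} = 1 := by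
  have := ν.P_prob p
  have h : {nuSTraj s p} = ⋂ n, cylSet (nuSHist s p n) := by
    ext ω
    simp only [Set.mem_singleton_iff, Set.mem_iInter, mem_cylSet_nuSHist]
    exact ⟨fun h _ i _ => by rw [h], fun h => funext fun i => h (i + 1) i i.lt_succ_self⟩
  have hm : ∀ n, MeasurableSet (cylSet (nuSHist s p n)) := fun n => measurableSet_cylSet _
  rw [h, ← prob_compl_eq_zero_iff (MeasurableSet.iInter hm), Set.compl_iInter,
    measure_iUnion_null_iff]
  exact fun n => (prob_compl_eq_zero_iff (hm n)).2 (P_cylSet_nuSHist hν p n)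

lemma P_eq_one_iff {ν : Environment Bool Unit 2} {s : ℕ} (hν : IsNuS ν s)
    (p : Policy Bool Unit 2) (A : Set (Traj Bool Unit 2)) :
    ν.P p A = 1 ↔ nuSTraj s p ∈ A := by
  have := ν.P_prob p
  have h1 := P_singleton_nuSTraj hν p
  constructor
  · intro hA
    by_contra hz
    have hm : MeasurableSet {nuSTraj s p} := MeasurableSet.singleton _
    have h0 := (prob_compl_eq_zero_iff hm).2 h1
    have : ν.P p A = 0 := measure_mono_null (fun ω hω => by
      rintro rfl; exact hz hω) h0
    simp [this] at hA
  · intro hz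
    exact le_antisymm prob_le_one (h1 ▸ measure_mono (Set.singleton_subset_iff.2 hz))

lemma rew_nonneg (z : Cycle Bool Unit 2) : 0 ≤ rew z := Nat.cast_nonneg _

lemma rew_le_two (z : Cycle Bool Unit 2) : rew z ≤ 2 := by
  have : (z.2.1 : ℕ) ≤ 2 := by omega
  unfold rew
  exact_mod_cast this

lemma avg_nonneg (ω : Traj Bool Unit 2) (m : ℕ) : 0 ≤ avg ω m :=
  div_nonneg (Finset.sum_nonneg fun _ _ => rew_nonneg _) (Nat.cast_nonneg _)

lemma avg_le_two (ω : Traj Bool Unit 2) (m : ℕ) : avg ω m ≤ 2 := by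
  refine div_le_of_le_mul₀ (Nat.cast_nonneg _) zero_le_two ?_
  refine (Finset.sum_le_card_nsmul _ _ 2 fun _ _ => rew_le_two _).trans_eq ?_
  simp [mul_comm]

lemma limsup_avg_le_two (ω : Traj Bool Unit 2) : limsup (avg ω) atTop ≤ 2 :=
  limsup_le_of_le (IsCoboundedUnder.of_frequently_ge (a := 0)
    (Frequently.of_forall (avg_nonneg ω))) (Eventually.of_forall (avg_le_two ω))

lemma fourthRoot_succ_le (n : ℕ) : (n + 1).sqrt.sqrt ≤ n.sqrt.sqrt + 1 :=
  (Nat.sqrt_le_sqrt (Nat.sqrt_succ_le_succ_sqrt n)).trans (Nat.sqrt_succ_le_succ_sqrt _)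

lemma fourthRoot_le_succ (n : ℕ) : n.sqrt.sqrt ≤ (n + 1).sqrt.sqrt :=
  Nat.sqrt_le_sqrt (Nat.sqrt_le_sqrt n.le_succ)

lemma fourthRoot_pow_le (n : ℕ) : n.sqrt.sqrt ^ 4 ≤ n := by
  calc n.sqrt.sqrt ^ 4 = (n.sqrt.sqrt ^ 2) ^ 2 := by ring
    _ ≤ n.sqrt ^ 2 := by gcongr; exact Nat.sqrt_le' _
    _ ≤ n := Nat.sqrt_le' _

lemma le_fourthRoot {m n : ℕ} (h : m ^ 4 ≤ n) : m ≤ n.sqrt.sqrt := by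
  rw [Nat.le_sqrt', Nat.le_sqrt']
  calc (m ^ 2) ^ 2 = m ^ 4 := by ring
    _ ≤ n := h

/-- The policy that plays `a` exactly when the integer part of the fourth root of the time
increases. -/
def sparsePolicy : Policy Bool Unit 2 := fun h =>
  decide (h.length.sqrt.sqrt < (h.length + 1).sqrt.sqrt)

lemma nuSTraj_sparsePolicy_fst (s n : ℕ) :
    (nuSTraj s sparsePolicy n).1 = decide (n.sqrt.sqrt < (n + 1).sqrt.sqrt) := by
  simp [nuSTraj, sparsePolicy, length_nuSHist]

lemma countA_nuSHist_succ (s : ℕ) (p : Policy Bool Unit 2) (n : ℕ) :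
    countA ((nuSHist s p (n + 1)).map Prod.fst) =
      countA ((nuSHist s p n).map Prod.fst) + if (nuSTraj s p n).1 then 1 else 0 := by
  rw [nuSHist_succ, List.map_append, List.map_singleton, countA_append]

lemma countA_sparsePolicy (s n : ℕ) :
    countA ((nuSHist s sparsePolicy n).map Prod.fst) = n.sqrt.sqrt := by
  induction n with
  | zero => simp [nuSHist, countA]
  | succ n ih =>
    rw [countA_nuSHist_succ, ih, nuSTraj_sparsePolicy_fst]
    have h1 := fourthRoot_succ_le n
    have h2 := fourthRoot_le_succ n
    by_cases h : n.sqrt.sqrt < (n + 1).sqrt.sqrt <;> simp [h] <;> omega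

lemma rew_nuSTraj (s : ℕ) (p : Policy Bool Unit 2) (n : ℕ) :
    rew (nuSTraj s p n) = if (nuSTraj s p n).1 then 1 else
      if countA ((nuSHist s p (n + 1)).map Prod.fst) <
          longestRunB ((nuSHist s p (n + 1)).map Prod.fst) ∧
        s ≤ countA ((nuSHist s p (n + 1)).map Prod.fst) then 2 else 0 := by
  rw [nuSHist_succ, List.map_append, List.map_singleton]
  unfold rew
  change (((nuSReward s ((nuSHist s p n).map Prod.fst) (nuSTraj s p n).1 : Fin 3) : ℕ) : ℝ) = _
  unfold nuSReward
  split_ifs <;> simp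

lemma rew_sparsePolicy_eq {s n : ℕ} (h : (s + 2) ^ 4 ≤ n) :
    rew (nuSTraj s sparsePolicy n) = 2 - (((n + 1).sqrt.sqrt : ℝ) - n.sqrt.sqrt) := by
  have hs : s + 2 ≤ (n + 1).sqrt.sqrt := le_fourthRoot (h.trans n.le_succ)
  have h4 := fourthRoot_pow_le (n + 1)
  have hc := countA_sparsePolicy s (n + 1)
  have hlong : countA ((nuSHist s sparsePolicy (n + 1)).map Prod.fst) <
      longestRunB ((nuSHist s sparsePolicy (n + 1)).map Prod.fst) := by
    apply countA_lt_longestRunB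
    rw [hc, List.length_map, length_nuSHist]
    refine le_trans ?_ h4
    set f := (n + 1).sqrt.sqrt
    have h2 : f + 1 ≤ f ^ 2 := by nlinarith
    calc (f + 1) ^ 2 ≤ (f ^ 2) ^ 2 := by gcongr
      _ = f ^ 4 := by ring
  rw [rew_nuSTraj, nuSTraj_sparsePolicy_fst,
    if_pos (And.intro hlong (by omega : s ≤ countA _))]
  have h1 := fourthRoot_succ_le n
  have h2 := fourthRoot_le_succ n
  by_cases hlt : n.sqrt.sqrt < (n + 1).sqrt.sqrt
  · have : (n + 1).sqrt.sqrt = n.sqrt.sqrt + 1 := by omega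
    rw [this]; simp; norm_num
  · have : (n + 1).sqrt.sqrt = n.sqrt.sqrt := by omega
    simp [this]

lemma le_sum_rew_sparsePolicy (s n : ℕ) :
    2 * (n : ℝ) - n.sqrt.sqrt - 2 * (s + 2) ^ 4 ≤
      ∑ i ∈ Finset.range n, rew (nuSTraj s sparsePolicy i) := by
  induction n with
  | zero => simp; positivity
  | succ n ih =>
    by_cases h : (s + 2) ^ 4 ≤ n
    · rw [Finset.sum_range_succ, rew_sparsePolicy_eq h]
      push_cast
      linarith
    · have h' : n + 1 ≤ (s + 2) ^ 4 := by omega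
      have h'' : ((n + 1 : ℕ) : ℝ) ≤ (s + 2) ^ 4 := by exact_mod_cast h'
      have h0 : (0 : ℝ) ≤ ∑ i ∈ Finset.range (n + 1), rew (nuSTraj s sparsePolicy i) :=
        Finset.sum_nonneg fun _ _ => rew_nonneg _
      have h1 : (0 : ℝ) ≤ ((n + 1).sqrt.sqrt : ℝ) := Nat.cast_nonneg _
      linarith

lemma tendsto_fourthRoot_div : Tendsto (fun n : ℕ => (n.sqrt.sqrt : ℝ) / n) atTop (nhds 0) := by
  have h : Tendsto (fun n : ℕ => 1 / Real.sqrt n) atTop (nhds 0) := by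
    simp only [one_div]
    exact (Real.tendsto_sqrt_atTop.comp tendsto_natCast_atTop_atTop).inv_tendsto_atTop
  refine squeeze_zero (fun n => by positivity) (fun n => ?_) h
  rw [← Real.sqrt_div_self']
  gcongr
  apply Real.le_sqrt_of_sq_le
  have h4 : n.sqrt.sqrt ^ 2 ≤ n := (Nat.sqrt_le' _).trans (Nat.sqrt_le_self _)
  exact_mod_cast h4

lemma tendsto_avg_sparsePolicy (s : ℕ) :
    Tendsto (avg (nuSTraj s sparsePolicy)) atTop (nhds 2) := by
  have h : Tendsto (fun n : ℕ => 2 - (n.sqrt.sqrt : ℝ) / n - (2 * (s + 2) ^ 4 : ℝ) / n)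
      atTop (nhds 2) := by
    simpa using (tendsto_fourthRoot_div.const_sub 2).sub
      (tendsto_const_div_atTop_nhds_zero_nat (2 * (s + 2) ^ 4 : ℝ))
  refine tendsto_of_tendsto_of_tendsto_of_le_of_le' h tendsto_const_nhds ?_
    (Eventually.of_forall (avg_le_two _))
  filter_upwards [eventually_gt_atTop 0] with n hn
  have hn' : (0 : ℝ) < n := Nat.cast_pos.2 hn
  unfold avg
  rw [le_div_iff₀ hn']
  refine le_trans (le_of_eq ?_) (le_sum_rew_sparsePolicy s n)
  field_simp

lemma valueIs_sparsePolicy {ν : Environment Bool Unit 2} {s : ℕ} (hν : IsNuS ν s) :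
    ValueIs ν sparsePolicy 2 :=
  (P_eq_one_iff hν _ _).2 (tendsto_avg_sparsePolicy s)

lemma isOptimalValue_two {ν : Environment Bool Unit 2} {s : ℕ} (hν : IsNuS ν s) :
    IsOptimalValue ν 2 :=
  ⟨sparsePolicy, valueIs_sparsePolicy hν,
    fun q => (P_eq_one_iff hν q _).2 (limsup_avg_le_two _)⟩

lemma IsOptimalValue.eq_two {ν : Environment Bool Unit 2} {s : ℕ} (hν : IsNuS ν s) {V : ℝ}
    (hV : IsOptimalValue ν V) : V = 2 := by
  obtain ⟨p, hp, hq⟩ := hV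
  have h1 : Tendsto (avg (nuSTraj s p)) atTop (nhds V) := (P_eq_one_iff hν p _).1 hp
  have h2 : limsup (avg (nuSTraj s sparsePolicy)) atTop ≤ V := (P_eq_one_iff hν _ _).1 (hq _)
  rw [(tendsto_avg_sparsePolicy s).limsup_eq] at h2
  exact le_antisymm (le_of_tendsto' h1 (avg_le_two _)) h2

lemma nuSHist_replacePolicy (s k : ℕ) (p : Policy Bool Unit 2) {n : ℕ} (hn : n ≤ k) :
    nuSHist s (replacePolicy (List.replicate k (true, ((1 : Fin 3), ()))) p) n =
      List.replicate n (true, ((1 : Fin 3), ())) := by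
  induction n with
  | zero => rfl
  | succ n ih =>
    have h := ih (by omega)
    have hlt : n < k := by omega
    rw [nuSHist, h, List.replicate_succ']
    simp [replacePolicy, hlt, nuSReward]

lemma le_countA_nuSHist (s k : ℕ) (p : Policy Bool Unit 2) (n : ℕ) :
    k ≤ countA ((nuSHist s (replacePolicy (List.replicate k (true, ((1 : Fin 3), ()))) p)
      (k + n)).map Prod.fst) := by
  induction n with
  | zero => simp [nuSHist_replacePolicy, countA]
  | succ n ih =>
    rw [← add_assoc, countA_nuSHist_succ]
    exact ih.trans (Nat.le_add_right _ _)

lemma rew_replacePolicy_le_one (s k : ℕ) (p : Policy Bool Unit 2) {i : ℕ} (hk : k ≤ i)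
    (hi : i < 2 * k) :
    rew (nuSTraj s (replacePolicy (List.replicate k (true, ((1 : Fin 3), ()))) p) i) ≤ 1 := by
  obtain ⟨n, rfl⟩ := Nat.exists_eq_add_of_le hk
  have h1 := le_countA_nuSHist s k p (n + 1)
  have h2 := runState_snd_add_countA_le
    ((nuSHist s (replacePolicy (List.replicate k (true, ((1 : Fin 3), ()))) p)
      (k + n + 1)).map Prod.fst)
  rw [List.length_map, length_nuSHist, ← longestRunB_eq] at h2
  rw [← add_assoc] at h1
  rw [rew_nuSTraj, if_neg (by omega : ¬ (_ ∧ _))]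
  split_ifs <;> norm_num

lemma condProb_replicate_eq_one {ν : Environment Bool Unit 2} {s : ℕ} (hν : IsNuS ν s) (k : ℕ)
    (p : Policy Bool Unit 2) {A : Set (Traj Bool Unit 2)}
    (hA : nuSTraj s (replacePolicy (List.replicate k (true, ((1 : Fin 3), ()))) p) ∈ A) :
    condProb ν p (List.replicate k (true, ((1 : Fin 3), ()))) A = 1 := by
  set h : List (Cycle Bool Unit 2) := List.replicate k (true, ((1 : Fin 3), ()))
  have hH : nuSHist s (replacePolicy h p) k = h := nuSHist_replacePolicy s k p le_rfl
  have hc : ν.P (replacePolicy h p) (cylSet h) = 1 := by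
    have := P_cylSet_nuSHist hν (replacePolicy h p) k
    rwa [hH] at this
  have hz : nuSTraj s (replacePolicy h p) ∈ cylSet h := (P_eq_one_iff hν _ _).1 hc
  rw [condProb, condMeasure, ProbabilityTheory.cond_apply (measurableSet_cylSet h), hc,
    (P_eq_one_iff hν _ _).2 (Set.mem_inter hz hA)]
  simp

lemma not_valueStable {ν : Environment Bool Unit 2} {s : ℕ} (hν : IsNuS ν s) :
    ¬ ValueStable ν := by
  rintro ⟨V, r, d, φ, hV, -, hr, hd, hφ, hstab⟩
  obtain rfl := hV.eq_two hν
  have hε : (0 : ℝ) < 1 / 4 := by norm_num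
  set S : ℕ → ℝ := fun n => ∑ i ∈ Finset.range n, r i
  have h2k : Tendsto (fun k : ℕ => 2 * (S (2 * k) / (2 * k : ℕ))) atTop (nhds (2 * 2)) :=
    (hr.comp (tendsto_id.const_mul_atTop' two_pos)).const_mul 2
  have hlim := (h2k.sub hr).sub (hd _ hε).tendsto_div_nhds_zero
  have hev := hlim.eventually_const_lt (show (3 / 2 : ℝ) < 2 * 2 - 2 - 0 by norm_num)
  have hev' := (tendsto_add_atTop_nat 1).eventually hev
  have hφ' := (hφ _ hε).tendsto_atTop_zero.eventually_lt_const one_pos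
  obtain ⟨m, hm, hφm⟩ := (hev'.and hφ').exists
  obtain ⟨p, hp⟩ := hstab (List.replicate (m + 1) (true, ((1 : Fin 3), ())))
  have hle := hp _ hε m
  rw [condProb_replicate_eq_one hν] at hle
  · rw [ENNReal.one_le_ofReal] at hle
    linarith
  · rw [Set.mem_ofPred_eq, List.length_replicate]
    have hIcc : Finset.Icc (m + 1) (m + 1 + m) = Finset.Ico (m + 1) (2 * (m + 1)) := by
      ext i; simp only [Finset.mem_Icc, Finset.mem_Ico]; omega
    rw [hIcc, Finset.sum_Ico_eq_sub _ (by omega : m + 1 ≤ 2 * (m + 1))]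
    have hrew := Finset.sum_le_card_nsmul (Finset.Ico (m + 1) (2 * (m + 1)))
      (fun i => rew (nuSTraj s (replacePolicy
        (List.replicate (m + 1) (true, ((1 : Fin 3), ()))) p) i)) 1 (fun i hi =>
        rew_replacePolicy_le_one s (m + 1) p (Finset.mem_Ico.1 hi).1 (Finset.mem_Ico.1 hi).2)
    have hcard : 2 * (m + 1) - (m + 1) = m + 1 := by omega
    rw [Nat.card_Ico, hcard, nsmul_eq_mul, mul_one] at hrew
    have hpos : (0 : ℝ) < (m : ℝ) + 1 := by positivity
    have hS : 3 / 2 * ((m : ℝ) + 1) < S (2 * (m + 1)) - S (m + 1) - d (m + 1) (1 / 4) := by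
      rw [← lt_div_iff₀ hpos]
      refine hm.trans_eq ?_
      push_cast
      field_simp
      rfl
    push_cast at hrew
    change _ < S (2 * (m + 1)) - S (m + 1) - _
    linarith

/-- **Value-stability is not necessary for self-optimizingness.**
The countable class `{ν_s : s > 0}` consists of explorable environments none of which is
value-stable, yet there exists a single policy `p` with `V(ν_s, p) = V*_{ν_s}` for every
`s > 0`. -/
theorem not_valueStable_but_selfOptimizing
    (ν : ℕ → Environment Bool Unit 2) (hν : ∀ s, 0 < s → IsNuS (ν s) s) :
    (∀ s, 0 < s → Explorable (ν s) ∧ ¬ ValueStable (ν s)) ∧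
    ∃ p : Policy Bool Unit 2, ∀ s, 0 < s →
      ∀ V, IsOptimalValue (ν s) V → ValueIs (ν s) p V :=
  ⟨fun s hs => ⟨⟨2, isOptimalValue_two (hν s hs)⟩, not_valueStable (hν s hs)⟩,
    sparsePolicy, fun s hs V hV => by
      rw [hV.eq_two (hν s hs)]
      exact valueIs_sparsePolicy (hν s hs)⟩

end RL
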